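/- arXiv:2601.05377 — 9 statements merged into one kernel-verified Lean document; each statement's English description precedes it below -/
import Mathlib

section
/- Let 0 < a < 1/2. Then γ*(a) = 1/(ū₁(1−ū₁)) = (ū₁ − a)/f(ū₁); furthermore (u₁ − a)/f(u₁) = 9/(1+2a−2a² − (1−2a)√(a²−a+1)) and this value is strictly greater than γ*(a); finally 0 < γ*(a) < 6. -/
open Real

noncomputable def fcube (a u : ℝ) : ℝ := u * (u - a) * (1 - u)

noncomputable def uOne (a : ℝ) : ℝ := (1 + a - Real.sqrt (1 - a + a ^ 2)) / 3
noncomputable def uBarOne (a : ℝ) : ℝ := (1 + a + Real.sqrt (1 - a + a ^ 2)) / 3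
noncomputable def uTwo (a : ℝ) : ℝ := (1 + a + 2 * Real.sqrt (1 - a + a ^ 2)) / 3
noncomputable def uBarTwo (a : ℝ) : ℝ := (1 + a - 2 * Real.sqrt (1 - a + a ^ 2)) / 3

noncomputable def gammaStar (a : ℝ) : ℝ :=
  9 / (1 + 2 * a - 2 * a ^ 2 + (1 - 2 * a) * Real.sqrt (a ^ 2 - a + 1))

/-- alternative expressions for `γ*(a)`, the analogous expression at the
lower fold, its comparison with `γ*(a)`, and the bounds `0 < γ*(a) < 6`. -/
theorem stmt3 (a : ℝ) (ha0 : 0 < a) (ha : a < 1 / 2) :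
    gammaStar a = 1 / (uBarOne a * (1 - uBarOne a)) ∧
    gammaStar a = (uBarOne a - a) / fcube a (uBarOne a) ∧
    (uOne a - a) / fcube a (uOne a)
      = 9 / (1 + 2 * a - 2 * a ^ 2 - (1 - 2 * a) * Real.sqrt (a ^ 2 - a + 1)) ∧
    gammaStar a < (uOne a - a) / fcube a (uOne a) ∧
    0 < gammaStar a ∧ gammaStar a < 6 := by
  have hc : a ^ 2 - a + 1 = 1 - a + a ^ 2 := by ring
  unfold gammaStar fcube uOne uBarOne
  rw [hc]
  have hpos : 0 < 1 - a + a ^ 2 := by nlinarith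
  obtain ⟨s, hs⟩ : ∃ s, s = Real.sqrt (1 - a + a ^ 2) := ⟨_, rfl⟩
  have hs0 : 0 < s := hs ▸ Real.sqrt_pos.mpr hpos
  have hs2 : s ^ 2 = 1 - a + a ^ 2 := hs ▸ Real.sq_sqrt hpos.le
  rw [← hs]
  have h1 : s < 1 + a := by nlinarith
  have h2 : 1 - 2 * a < s := by nlinarith
  have h3 : a < 1 := by linarith
  have hbs : 0 < (1 - 2 * a) * s := mul_pos (by linarith) hs0
  have e1 : (1 + a + s) / 3 * (1 - (1 + a + s) / 3)
      = (1 + 2 * a - 2 * a ^ 2 + (1 - 2 * a) * s) / 9 := by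
    linear_combination (-1 / 9) * hs2
  have e2 : (1 + a - s) / 3 * (1 - (1 + a - s) / 3)
      = (1 + 2 * a - 2 * a ^ 2 - (1 - 2 * a) * s) / 9 := by
    linear_combination (-1 / 9) * hs2
  have p2 : 0 < 1 + 2 * a - 2 * a ^ 2 - (1 - 2 * a) * s := by
    have : 0 < (1 + a - s) / 3 * (1 - (1 + a - s) / 3) :=
      mul_pos (by linarith) (by linarith)
    linarith
  have p1 : 0 < 1 + 2 * a - 2 * a ^ 2 + (1 - 2 * a) * s := by linarith
  have key : ∀ u : ℝ, u - a ≠ 0 → (u - a) / (u * (u - a) * (1 - u)) = 1 / (u * (1 - u)) := by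
    intro u hu
    rw [show u * (u - a) * (1 - u) = (u - a) * (u * (1 - u)) by ring,
      div_mul_eq_div_div, div_self hu]
  have n1 : (1 + a + s) / 3 - a ≠ 0 := by
    have : 0 < (1 + a + s) / 3 - a := by linarith
    exact this.ne'
  have n2 : (1 + a - s) / 3 - a ≠ 0 := by
    have : (1 + a - s) / 3 - a < 0 := by linarith
    exact this.ne
  rw [key _ n1, key _ n2, e1, e2, one_div_div, one_div_div]
  refine ⟨rfl, rfl, rfl, ?_, by positivity, ?_⟩
  · exact div_lt_div_of_pos_left (by norm_num) p2 (by linarith)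
  · rw [div_lt_iff₀ p1]
    have : (1 - 2 * a) * (1 - 2 * a) < (1 - 2 * a) * s :=
      mul_lt_mul_of_pos_left h2 (by linarith)
    nlinarith
end

section
/- Let 0 < a < 1/2 and 0 < γ < γ*(a). Then u − γ f(u) − a < 0 for every u ≤ u₁, and u − γ f(u) − a > 0 for every u ≥ ū₁; in particular the nullcline u − γw − a = 0 does not intersect the left branch {(u, f(u)) : u ≤ u₁} or the right branch {(u, f(u)) : u ≥ ū₁} of the cubic w = f(u), and u₁ − γ f(u₁) − a < 0, u₂ − γ f(u₂) − a > 0, ū₁ − γ f(ū₁) − a > 0, ū₂ − γ f(ū₂) − a < 0. -/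
open Real

/-- in the oscillatory regime the quantity `u − γ f(u) − a` is negative on the
left branch `u ≤ u₁` and positive on the right branch `u ≥ ū₁`; in particular the nullcline
`u − γ w − a = 0` does not intersect those branches of `w = f(u)`, and the four sign
conditions at `u₁, u₂, ū₁, ū₂` hold. -/
theorem stmt4 (a γ : ℝ) (ha0 : 0 < a) (ha : a < 1 / 2)
    (hγ0 : 0 < γ) (hγ : γ < gammaStar a) :
    (∀ u : ℝ, u ≤ uOne a → u - γ * fcube a u - a < 0) ∧
    (∀ u : ℝ, uBarOne a ≤ u → 0 < u - γ * fcube a u - a) ∧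
    (∀ u w : ℝ, u ≤ uOne a → w = fcube a u → u - γ * w - a ≠ 0) ∧
    (∀ u w : ℝ, uBarOne a ≤ u → w = fcube a u → u - γ * w - a ≠ 0) ∧
    uOne a - γ * fcube a (uOne a) - a < 0 ∧
    0 < uTwo a - γ * fcube a (uTwo a) - a ∧
    0 < uBarOne a - γ * fcube a (uBarOne a) - a ∧
    uBarTwo a - γ * fcube a (uBarTwo a) - a < 0 := by
  have key : ∀ u : ℝ, u - γ * fcube a u - a = (u - a) * (1 - γ * (u * (1 - u))) := by
    intro u; unfold fcube; ring
  have hcomm : a ^ 2 - a + 1 = 1 - a + a ^ 2 := by ring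
  unfold gammaStar at hγ
  rw [hcomm] at hγ
  have hpos : 0 ≤ 1 - a + a ^ 2 := by nlinarith
  have hs2 := Real.sq_sqrt hpos
  have hs1 : 1 - 2 * a < √(1 - a + a ^ 2) := by
    apply Real.lt_sqrt_of_sq_lt; nlinarith
  unfold uOne uBarOne uTwo uBarTwo
  generalize √(1 - a + a ^ 2) = s at *
  have hp : 0 < (1 - 2 * a) * s := mul_pos (by linarith) (by linarith)
  have hD : 0 < 1 + 2 * a - 2 * a ^ 2 + (1 - 2 * a) * s := by nlinarith
  rw [lt_div_iff₀ hD] at hγ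
  have hL : ∀ u : ℝ, u ≤ (1 + a - s) / 3 → u - γ * fcube a u - a < 0 := by
    intro u hu
    rw [key]
    apply mul_neg_of_neg_of_pos
    · linarith
    · have h : u * (1 - u) ≤ (1 + 2 * a - 2 * a ^ 2 + (1 - 2 * a) * s) / 9 := by
        nlinarith [mul_nonneg (sub_nonneg.2 hu)
          (by linarith : 0 ≤ 1 - u - (1 + a - s) / 3)]
      have := mul_le_mul_of_nonneg_left h hγ0.le
      linarith
  have hR : ∀ u : ℝ, (1 + a + s) / 3 ≤ u → 0 < u - γ * fcube a u - a := by
    intro u hu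
    rw [key]
    have hs3 : 1 / 2 - a ≤ s := by linarith
    apply mul_pos
    · linarith
    · have h : u * (1 - u) ≤ (1 + 2 * a - 2 * a ^ 2 + (1 - 2 * a) * s) / 9 := by
        nlinarith [mul_nonneg (sub_nonneg.2 hu)
          (by linarith : 0 ≤ u + (1 + a + s) / 3 - 1)]
      have := mul_le_mul_of_nonneg_left h hγ0.le
      linarith
  refine ⟨hL, hR, ?_, ?_, hL _ le_rfl, hR _ (by linarith), hR _ le_rfl, hL _ (by linarith)⟩
  · rintro u w hu rfl
    exact (hL u hu).ne
  · rintro u w hu rfl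
    exact (hR u hu).ne'
end

section
/- Let 0 < a < 1/2 and 0 < γ < γ*(a). Then −1/2 < (u₁ − γ f(u₁) − a)/(u₂ − γ f(u₂) − a) < 0 and −2 < (ū₁ − γ f(ū₁) − a)/(ū₂ − γ f(ū₂) − a) < 0. -/
open Real

/-- the ratios `(u₁ − γ f(u₁) − a)/(u₂ − γ f(u₂) − a)` and
`(ū₁ − γ f(ū₁) − a)/(ū₂ − γ f(ū₂) − a)` lie in `(−1/2, 0)` and `(−2, 0)`, respectively. -/
theorem stmt5 (a γ : ℝ) (ha0 : 0 < a) (ha : a < 1 / 2)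
    (hγ0 : 0 < γ) (hγ : γ < gammaStar a) :
    (-(1 / 2 : ℝ) < (uOne a - γ * fcube a (uOne a) - a) / (uTwo a - γ * fcube a (uTwo a) - a) ∧
      (uOne a - γ * fcube a (uOne a) - a) / (uTwo a - γ * fcube a (uTwo a) - a) < 0) ∧
    (-(2 : ℝ) < (uBarOne a - γ * fcube a (uBarOne a) - a) /
        (uBarTwo a - γ * fcube a (uBarTwo a) - a) ∧
      (uBarOne a - γ * fcube a (uBarOne a) - a) /
        (uBarTwo a - γ * fcube a (uBarTwo a) - a) < 0) := by
  have hs : (a ^ 2 - a + 1) = 1 - a + a ^ 2 := by ring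
  unfold gammaStar at hγ
  rw [hs] at hγ
  unfold uOne uTwo uBarOne uBarTwo
  have hpos : 0 < 1 - a + a ^ 2 := by nlinarith
  obtain ⟨s, hsd⟩ : ∃ s, s = Real.sqrt (1 - a + a ^ 2) := ⟨_, rfl⟩
  have s0 : 0 < s := hsd ▸ Real.sqrt_pos.mpr hpos
  have s2 : s ^ 2 = 1 - a + a ^ 2 := hsd ▸ Real.sq_sqrt hpos.le
  rw [← hsd] at hγ ⊢
  have h1 : 1 - 2 * a < s := by nlinarith
  have h2 : s < 1 := by nlinarith
  have hK : 0 < 1 + 2 * a - 2 * a ^ 2 + (1 - 2 * a) * s := by nlinarith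
  rw [lt_div_iff₀ hK] at hγ
  have hp : 0 ≤ γ * ((1 - 2 * a) * s) := by
    have : 0 < 1 - 2 * a := by linarith
    positivity
  have e1 : fcube a ((1 + a + 2 * s) / 3) = fcube a ((1 + a - s) / 3) := by
    unfold fcube
    linear_combination (-s / 3) * s2
  have e2 : fcube a ((1 + a - 2 * s) / 3) = fcube a ((1 + a + s) / 3) := by
    unfold fcube
    linear_combination (s / 3) * s2
  have m1 : fcube a ((1 + a - s) / 3) < 0 := by
    unfold fcube
    apply mul_neg_of_neg_of_pos
    · apply mul_neg_of_pos_of_neg <;> linarith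
    · linarith
  have m2 : 0 < fcube a ((1 + a + s) / 3) := by
    unfold fcube
    apply mul_pos
    · apply mul_pos <;> linarith
    · linarith
  have N1 : (1 + a - s) / 3 - γ * fcube a ((1 + a - s) / 3) - a < 0 := by
    have : (1 + a - s) / 3 - γ * fcube a ((1 + a - s) / 3) - a
      = ((1 + a - s) / 3 - a) * (1 - γ * (1 + 2 * a - 2 * a ^ 2 - (1 - 2 * a) * s) / 9) := by
      unfold fcube
      linear_combination (γ * ((1 + a - s) / 3 - a) / 9) * s2
    rw [this]
    apply mul_neg_of_neg_of_pos <;> nlinarith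
  have N2 : 0 < (1 + a + s) / 3 - γ * fcube a ((1 + a + s) / 3) - a := by
    have : (1 + a + s) / 3 - γ * fcube a ((1 + a + s) / 3) - a
      = ((1 + a + s) / 3 - a) * (1 - γ * (1 + 2 * a - 2 * a ^ 2 + (1 - 2 * a) * s) / 9) := by
      unfold fcube
      linear_combination (γ * ((1 + a + s) / 3 - a) / 9) * s2
    rw [this]
    apply mul_pos <;> linarith
  rw [e1, e2]
  have g1 := mul_neg_of_pos_of_neg hγ0 m1
  have g2 := mul_pos hγ0 m2
  have D1 : 0 < (1 + a + 2 * s) / 3 - γ * fcube a ((1 + a - s) / 3) - a := by linarith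
  have D2 : (1 + a - 2 * s) / 3 - γ * fcube a ((1 + a + s) / 3) - a < 0 := by linarith
  refine ⟨⟨?_, div_neg_of_neg_of_pos N1 D1⟩, ?_, div_neg_of_pos_of_neg N2 D2⟩
  · rw [lt_div_iff₀ D1]; linarith
  · rw [lt_div_iff_of_neg D2]; linarith
end

section
/- Let 0 < a < 1/2 and set P = u₂ − γ f(u₂) − a and Q = ū₂ − γ f(ū₂) − a. Then for every γ ∈ ℝ one has the identities P + Q = (2(1−2a)/27)(9 + (−2−a+a²)γ) and P·Q = −(9 + 2(2−5a+5a²)γ + (1−a)²a²γ²)/27. Moreover, if in addition 0 < γ < γ*(a), then (P+Q)²/(4PQ) = −(1−2a)²(9+(−2−a+a²)γ)² / (27(9 + 2(2−5a+5a²)γ + (1−a)²a²γ²)) and this quantity is strictly greater than −1/3. -/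
open Real

/-- with `P = u₂ − γ f(u₂) − a` and `Q = ū₂ − γ f(ū₂) − a`, the identities for
`P + Q` and `P·Q` hold for every `γ`, and for `0 < γ < γ*(a)` the quantity `(P+Q)²/(4PQ)`
has the stated closed form and is strictly greater than `−1/3`. -/
theorem stmt6 (a : ℝ) (ha0 : 0 < a) (ha : a < 1 / 2) :
    (∀ γ : ℝ,
      (uTwo a - γ * fcube a (uTwo a) - a) + (uBarTwo a - γ * fcube a (uBarTwo a) - a)
        = (2 * (1 - 2 * a) / 27) * (9 + (-2 - a + a ^ 2) * γ) ∧
      (uTwo a - γ * fcube a (uTwo a) - a) * (uBarTwo a - γ * fcube a (uBarTwo a) - a)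
        = -(9 + 2 * (2 - 5 * a + 5 * a ^ 2) * γ + (1 - a) ^ 2 * a ^ 2 * γ ^ 2) / 27) ∧
    (∀ γ : ℝ, 0 < γ → γ < gammaStar a →
      ((uTwo a - γ * fcube a (uTwo a) - a) + (uBarTwo a - γ * fcube a (uBarTwo a) - a)) ^ 2 /
          (4 * ((uTwo a - γ * fcube a (uTwo a) - a) * (uBarTwo a - γ * fcube a (uBarTwo a) - a)))
        = -((1 - 2 * a) ^ 2 * (9 + (-2 - a + a ^ 2) * γ) ^ 2) /
            (27 * (9 + 2 * (2 - 5 * a + 5 * a ^ 2) * γ + (1 - a) ^ 2 * a ^ 2 * γ ^ 2)) ∧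
      -(1 / 3 : ℝ) <
        ((uTwo a - γ * fcube a (uTwo a) - a) + (uBarTwo a - γ * fcube a (uBarTwo a) - a)) ^ 2 /
          (4 * ((uTwo a - γ * fcube a (uTwo a) - a) *
            (uBarTwo a - γ * fcube a (uBarTwo a) - a)))) := by
  have key : ∀ γ : ℝ,
      (uTwo a - γ * fcube a (uTwo a) - a) + (uBarTwo a - γ * fcube a (uBarTwo a) - a)
        = (2 * (1 - 2 * a) / 27) * (9 + (-2 - a + a ^ 2) * γ) ∧
      (uTwo a - γ * fcube a (uTwo a) - a) * (uBarTwo a - γ * fcube a (uBarTwo a) - a)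
        = -(9 + 2 * (2 - 5 * a + 5 * a ^ 2) * γ + (1 - a) ^ 2 * a ^ 2 * γ ^ 2) / 27 := by
    intro γ
    have hs : Real.sqrt (1 - a + a ^ 2) ^ 2 = 1 - a + a ^ 2 :=
      Real.sq_sqrt (by nlinarith)
    unfold uTwo uBarTwo fcube
    generalize Real.sqrt (1 - a + a ^ 2) = s at hs
    have h3 : s ^ 3 = s * (1 - a + a ^ 2) := by rw [← hs]; ring
    have h4 : s ^ 4 = (1 - a + a ^ 2) ^ 2 := by rw [← hs]; ring
    have h6 : s ^ 6 = (1 - a + a ^ 2) ^ 3 := by rw [← hs]; ring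
    constructor
    · ring_nf
    · ring_nf
      simp only [hs, h4, h6]
      ring
  refine ⟨key, ?_⟩
  intro γ h0 h1
  obtain ⟨k1, k2⟩ := key γ
  rw [k1, k2]
  have hD : 0 < 9 + 2 * (2 - 5 * a + 5 * a ^ 2) * γ + (1 - a) ^ 2 * a ^ 2 * γ ^ 2 := by
    have : 0 < 2 - 5 * a + 5 * a ^ 2 := by nlinarith [sq_nonneg (a - 1 / 2)]
    positivity
  have heq : ((2 * (1 - 2 * a) / 27) * (9 + (-2 - a + a ^ 2) * γ)) ^ 2 /
          (4 * (-(9 + 2 * (2 - 5 * a + 5 * a ^ 2) * γ + (1 - a) ^ 2 * a ^ 2 * γ ^ 2) / 27))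
        = -((1 - 2 * a) ^ 2 * (9 + (-2 - a + a ^ 2) * γ) ^ 2) /
            (27 * (9 + 2 * (2 - 5 * a + 5 * a ^ 2) * γ + (1 - a) ^ 2 * a ^ 2 * γ ^ 2)) := by
    generalize 9 + 2 * (2 - 5 * a + 5 * a ^ 2) * γ + (1 - a) ^ 2 * a ^ 2 * γ ^ 2 = D at hD
    rw [div_eq_div_iff (by linarith) (by positivity)]
    ring
  refine ⟨heq, ?_⟩
  rw [heq, lt_div_iff₀ (by positivity)]
  have hsq : 1 - 2 * a ≤ Real.sqrt (a ^ 2 - a + 1) :=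
    Real.le_sqrt_of_sq_le (by nlinarith)
  obtain ⟨t, ht⟩ : ∃ t, t = a * (1 - a) := ⟨_, rfl⟩
  have ht0 : 0 < t := by rw [ht]; exact mul_pos ha0 (by linarith)
  have ht1 : t < 1 / 4 := by rw [ht]; nlinarith [mul_pos (sub_pos.2 ha) (sub_pos.2 ha)]
  have hden : 2 * (1 - t) ≤
      1 + 2 * a - 2 * a ^ 2 + (1 - 2 * a) * Real.sqrt (a ^ 2 - a + 1) := by
    rw [ht]
    nlinarith [mul_le_mul_of_nonneg_left hsq (by linarith : 0 ≤ 1 - 2 * a)]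
  have hg : γ * (1 - t) < 9 / 2 := by
    unfold gammaStar at h1
    rw [lt_div_iff₀ (by linarith)] at h1
    nlinarith [mul_le_mul_of_nonneg_left hden h0.le]
  have hlin : 0 ≤ 18 * (1 - 3 * t - t ^ 2) + (t ^ 3 + 6 * t ^ 2 + 3 * t - 1) * γ := by
    have hA : 0 < 1 - 3 * t - t ^ 2 := by nlinarith
    rcases le_total 0 (t ^ 3 + 6 * t ^ 2 + 3 * t - 1) with hc | hc
    · positivity
    · have h2 := mul_le_mul_of_nonpos_left hg.le hc
      have h3 : 0 ≤ 3 - 13 * t + 14 * t ^ 2 + 5 * t ^ 3 := by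
        have : 0 < t ^ 3 := by positivity
        nlinarith [sq_nonneg (t - 1 / 4)]
      by_contra hn
      push Not at hn
      have := mul_neg_of_neg_of_pos hn (by linarith : 0 < 1 - t)
      linarith
  have hfin : 0 < 81 * t +
      (18 * (1 - 3 * t - t ^ 2) + (t ^ 3 + 6 * t ^ 2 + 3 * t - 1) * γ) * γ := by
    positivity
  rw [ht] at hfin
  linarith
end

section
/- Let 0 < a < 1/2 and 0 < γ < γ*(a). Then 9 + 2(2−5a+5a²)γ + (1−a)²a²γ² > 0, the identity (1 + (u₁−u₂)/(u₂ − γ f(u₂) − a))·(1 + (ū₁−ū₂)/(ū₂ − γ f(ū₂) − a)) = a(1−a)(9 − (2+4a−4a²)γ + a(1−a)γ²) / (9 + 2(2−5a+5a²)γ + (1−a)²a²γ²) holds, and the common value lies in the open interval (−1/2, 1/2). -/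
open Real

/-- positivity of the denominator, the closed-form identity for the product
`(1 + (u₁−u₂)/(u₂ − γf(u₂) − a))·(1 + (ū₁−ū₂)/(ū₂ − γf(ū₂) − a))`, and the bound that this
value lies in `(−1/2, 1/2)`. -/
theorem stmt7 (a γ : ℝ) (ha0 : 0 < a) (ha : a < 1 / 2)
    (hγ0 : 0 < γ) (hγ : γ < gammaStar a) :
    0 < 9 + 2 * (2 - 5 * a + 5 * a ^ 2) * γ + (1 - a) ^ 2 * a ^ 2 * γ ^ 2 ∧
    (1 + (uOne a - uTwo a) / (uTwo a - γ * fcube a (uTwo a) - a)) *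
        (1 + (uBarOne a - uBarTwo a) / (uBarTwo a - γ * fcube a (uBarTwo a) - a))
      = a * (1 - a) * (9 - (2 + 4 * a - 4 * a ^ 2) * γ + a * (1 - a) * γ ^ 2) /
          (9 + 2 * (2 - 5 * a + 5 * a ^ 2) * γ + (1 - a) ^ 2 * a ^ 2 * γ ^ 2) ∧
    -(1 / 2 : ℝ) <
      (1 + (uOne a - uTwo a) / (uTwo a - γ * fcube a (uTwo a) - a)) *
        (1 + (uBarOne a - uBarTwo a) / (uBarTwo a - γ * fcube a (uBarTwo a) - a)) ∧
    (1 + (uOne a - uTwo a) / (uTwo a - γ * fcube a (uTwo a) - a)) *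
        (1 + (uBarOne a - uBarTwo a) / (uBarTwo a - γ * fcube a (uBarTwo a) - a))
      < 1 / 2 := by
  have hs2 : Real.sqrt (1 - a + a ^ 2) ^ 2 = 1 - a + a ^ 2 :=
    Real.sq_sqrt (by nlinarith)
  have hγ9 : γ < 9 := by
    refine lt_of_lt_of_le hγ ?_
    unfold gammaStar
    have h0 : 0 ≤ (1 - 2 * a) * Real.sqrt (a ^ 2 - a + 1) :=
      mul_nonneg (by linarith) (Real.sqrt_nonneg _)
    have h1 : 1 ≤ 1 + 2 * a - 2 * a ^ 2 + (1 - 2 * a) * Real.sqrt (a ^ 2 - a + 1) := by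
      nlinarith
    rw [div_le_iff₀ (by linarith)]
    linarith
  have hs0 := Real.sqrt_nonneg (1 - a + a ^ 2)
  obtain ⟨c, hc⟩ : ∃ c, c = a * (1 - a) := ⟨_, rfl⟩
  have hc0 : 0 < c := by rw [hc]; exact mul_pos ha0 (by linarith)
  have hc4 : c ≤ 1 / 4 := by rw [hc]; nlinarith [sq_nonneg (a - 1 / 2)]
  have hDc : 9 + 2 * (2 - 5 * a + 5 * a ^ 2) * γ + (1 - a) ^ 2 * a ^ 2 * γ ^ 2
      = 9 + (4 - 10 * c) * γ + c ^ 2 * γ ^ 2 := by rw [hc]; ring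
  have hNc : a * (1 - a) * (9 - (2 + 4 * a - 4 * a ^ 2) * γ + a * (1 - a) * γ ^ 2)
      = c * (9 - (2 + 4 * c) * γ + c * γ ^ 2) := by rw [hc]; ring
  have hD : 0 < 9 + 2 * (2 - 5 * a + 5 * a ^ 2) * γ + (1 - a) ^ 2 * a ^ 2 * γ ^ 2 := by
    rw [hDc]
    have : 0 < (4 - 10 * c) * γ := mul_pos (by linarith) hγ0
    positivity
  have key : (1 + (uOne a - uTwo a) / (uTwo a - γ * fcube a (uTwo a) - a)) *
        (1 + (uBarOne a - uBarTwo a) / (uBarTwo a - γ * fcube a (uBarTwo a) - a))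
      = a * (1 - a) * (9 - (2 + 4 * a - 4 * a ^ 2) * γ + a * (1 - a) * γ ^ 2) /
          (9 + 2 * (2 - 5 * a + 5 * a ^ 2) * γ + (1 - a) ^ 2 * a ^ 2 * γ ^ 2) := by
    unfold uOne uTwo uBarOne uBarTwo fcube
    generalize Real.sqrt (1 - a + a ^ 2) = s at hs2 hs0
    have hprod : ((1 + a + 2 * s) / 3 - γ * ((1 + a + 2 * s) / 3 * ((1 + a + 2 * s) / 3 - a)
        * (1 - (1 + a + 2 * s) / 3)) - a) * ((1 + a - 2 * s) / 3 - γ * ((1 + a - 2 * s) / 3 *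
        ((1 + a - 2 * s) / 3 - a) * (1 - (1 + a - 2 * s) / 3)) - a)
        = -(9 + 2 * (2 - 5 * a + 5 * a ^ 2) * γ + (1 - a) ^ 2 * a ^ 2 * γ ^ 2) / 27 := by
      have h1 : ((1 + a + 2 * s) / 3 - a) * ((1 + a - 2 * s) / 3 - a) = - 1 / 3 := by
        linear_combination (-4 / 9) * hs2
      have h2 : (1 - γ * ((1 + a + 2 * s) / 3 * (1 - (1 + a + 2 * s) / 3))) *
          (1 - γ * ((1 + a - 2 * s) / 3 * (1 - (1 + a - 2 * s) / 3)))
          = (9 + 2 * (2 - 5 * a + 5 * a ^ 2) * γ + (1 - a) ^ 2 * a ^ 2 * γ ^ 2) / 9 := by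
        grind
      linear_combination ((1 - γ * ((1 + a + 2 * s) / 3 * (1 - (1 + a + 2 * s) / 3))) *
          (1 - γ * ((1 + a - 2 * s) / 3 * (1 - (1 + a - 2 * s) / 3)))) * h1 + (-1 / 3) * h2
    have hnum : ((1 + a - s) / 3 - γ * ((1 + a + 2 * s) / 3 * ((1 + a + 2 * s) / 3 - a)
        * (1 - (1 + a + 2 * s) / 3)) - a) * ((1 + a + s) / 3 - γ * ((1 + a - 2 * s) / 3 *
        ((1 + a - 2 * s) / 3 - a) * (1 - (1 + a - 2 * s) / 3)) - a)
        = -(a * (1 - a) * (9 - (2 + 4 * a - 4 * a ^ 2) * γ + a * (1 - a) * γ ^ 2)) / 27 := by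
      grind
    generalize hA : ((1 + a + 2 * s) / 3 - γ * ((1 + a + 2 * s) / 3 * ((1 + a + 2 * s) / 3 - a)
        * (1 - (1 + a + 2 * s) / 3)) - a) = A at *
    generalize hB : ((1 + a - 2 * s) / 3 - γ * ((1 + a - 2 * s) / 3 *
        ((1 + a - 2 * s) / 3 - a) * (1 - (1 + a - 2 * s) / 3)) - a) = B at *
    have hAB : A * B ≠ 0 := by
      rw [hprod]; apply ne_of_lt; linarith
    have hA0 : A ≠ 0 := left_ne_zero_of_mul hAB
    have hB0 : B ≠ 0 := right_ne_zero_of_mul hAB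
    have e1 : 1 + ((1 + a - s) / 3 - (1 + a + 2 * s) / 3) / A = (A - s) / A := by
      field_simp; ring
    have e2 : 1 + ((1 + a + s) / 3 - (1 + a - 2 * s) / 3) / B = (B + s) / B := by
      field_simp; ring
    have e3 : (A - s) * (B + s)
        = -(a * (1 - a) * (9 - (2 + 4 * a - 4 * a ^ 2) * γ + a * (1 - a) * γ ^ 2)) / 27 := by
      rw [← hnum, ← hA, ← hB]; ring
    rw [e1, e2, div_mul_div_comm, e3, hprod, div_div_div_cancel_right₀ (by norm_num), neg_div_neg_eq]
  refine ⟨hD, key, ?_, ?_⟩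
  · rw [key, lt_div_iff₀ hD, hDc, hNc]
    have h1 : 0 ≤ (4 - 14 * c - 8 * c ^ 2) * γ := mul_nonneg (by nlinarith) hγ0.le
    have h2 : 0 ≤ c ^ 2 * γ ^ 2 := by positivity
    nlinarith
  · rw [key, div_lt_iff₀ hD, hDc, hNc]
    have h1 : 0 ≤ (4 - 6 * c - c ^ 2) * γ := mul_nonneg (by nlinarith) hγ0.le
    have h2 : 0 ≤ c ^ 2 * (γ * (9 - γ)) :=
      mul_nonneg (by positivity) (mul_nonneg hγ0.le (by linarith))
    nlinarith
end

section
/- Let 0 < a < 1/2 and 0 < γ < γ*(a), and let x^{1/3} denote the real cube root. Then (u₁ − γ f(u₁) − a)^{1/3}·(u₂ − γ f(u₂) − a) < 0 and (ū₁ − γ f(ū₁) − a)^{1/3}·(ū₂ − γ f(ū₂) − a) < 0. Consequently, for every c > 0 and every Ω₀ > 0, the number κ = −(2Ω₀(1−a+a²)^{1/3}/(3c²)) · ( 1/((u₁ − γ f(u₁) − a)^{1/3}(u₂ − γ f(u₂) − a)) + 1/((ū₁ − γ f(ū₁) − a)^{1/3}(ū₂ − γ f(ū₂) − a)) ) is strictly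 positive. -/
open Real

/-- The real cube root `x^{1/3}` of a real number. -/
noncomputable def rcbrt (x : ℝ) : ℝ := Real.sign x * |x| ^ ((1 : ℝ) / 3)

lemma rcbrt_pos_aux {x : ℝ} (h : 0 < x) : 0 < rcbrt x := by
  unfold rcbrt
  rw [Real.sign_of_pos h, one_mul]
  exact Real.rpow_pos_of_pos (abs_pos.mpr h.ne') _

lemma rcbrt_neg_aux {x : ℝ} (h : x < 0) : rcbrt x < 0 := by
  unfold rcbrt
  rw [Real.sign_of_neg h]
  have := Real.rpow_pos_of_pos (abs_pos.mpr h.ne) ((1 : ℝ) / 3)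
  linarith

lemma fac_aux (a γ u : ℝ) : u - γ * fcube a u - a = (u - a) * (1 - γ * (u * (1 - u))) := by
  unfold fcube
  ring

/-- the two cube-root products are negative, and consequently the
coefficient `κ` is strictly positive for every `c > 0` and `Ω₀ > 0`. -/
theorem stmt8 (a γ : ℝ) (ha0 : 0 < a) (ha : a < 1 / 2)
    (hγ0 : 0 < γ) (hγ : γ < gammaStar a) :
    rcbrt (uOne a - γ * fcube a (uOne a) - a) * (uTwo a - γ * fcube a (uTwo a) - a) < 0 ∧
    rcbrt (uBarOne a - γ * fcube a (uBarOne a) - a) *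
      (uBarTwo a - γ * fcube a (uBarTwo a) - a) < 0 ∧
    ∀ c Ω₀ : ℝ, 0 < c → 0 < Ω₀ →
      0 < -(2 * Ω₀ * rcbrt (1 - a + a ^ 2) / (3 * c ^ 2)) *
        (1 / (rcbrt (uOne a - γ * fcube a (uOne a) - a) *
              (uTwo a - γ * fcube a (uTwo a) - a)) +
         1 / (rcbrt (uBarOne a - γ * fcube a (uBarOne a) - a) *
              (uBarTwo a - γ * fcube a (uBarTwo a) - a))) := by
  have hpos : 0 < 1 - a + a ^ 2 := by nlinarith
  have e : a ^ 2 - a + 1 = 1 - a + a ^ 2 := by ring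
  unfold gammaStar at hγ
  rw [e] at hγ
  simp only [fac_aux]
  unfold uOne uTwo uBarOne uBarTwo
  have hs2 := Real.sq_sqrt hpos.le
  have hs0 := Real.sqrt_pos.mpr hpos
  set s := Real.sqrt (1 - a + a ^ 2) with hs
  have hD : 0 < 1 + 2 * a - 2 * a ^ 2 + (1 - 2 * a) * s := by
    have : 0 < (1 - 2 * a) * s := mul_pos (by linarith) hs0
    nlinarith
  rw [lt_div_iff₀ hD] at hγ
  have h1 : 1 - 2 * a < s := by
    apply lt_of_pow_lt_pow_left₀ 2 hs0.le
    nlinarith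
  have h2 : 2 - a < 2 * s := by
    apply lt_of_pow_lt_pow_left₀ 2 (by linarith)
    nlinarith
  have h3 : 1 + a < 2 * s := by
    apply lt_of_pow_lt_pow_left₀ 2 (by linarith)
    nlinarith
  have p1 : ((1 + a - s) / 3 - a) * (1 - γ * ((1 + a - s) / 3 * (1 - (1 + a - s) / 3))) < 0 := by
    apply mul_neg_of_neg_of_pos (by linarith)
    have : 0 < γ * ((1 - 2 * a) * s) := mul_pos hγ0 (mul_pos (by linarith) hs0)
    have e1 : (1 + a - s) / 3 * (1 - (1 + a - s) / 3)
        = (1 + 2 * a - 2 * a ^ 2 - (1 - 2 * a) * s) / 9 := by linear_combination (-1 / 9) * hs2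
    rw [e1]
    linarith
  have p3 : 0 < ((1 + a + s) / 3 - a) * (1 - γ * ((1 + a + s) / 3 * (1 - (1 + a + s) / 3))) := by
    apply mul_pos (by linarith)
    have e1 : (1 + a + s) / 3 * (1 - (1 + a + s) / 3)
        = (1 + 2 * a - 2 * a ^ 2 + (1 - 2 * a) * s) / 9 := by linear_combination (-1 / 9) * hs2
    rw [e1]
    linarith
  have p2 : 0 < ((1 + a + 2 * s) / 3 - a) *
      (1 - γ * ((1 + a + 2 * s) / 3 * (1 - (1 + a + 2 * s) / 3))) := by
    apply mul_pos (by linarith)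
    have : γ * ((1 + a + 2 * s) / 3 * (1 - (1 + a + 2 * s) / 3)) < 0 :=
      mul_neg_of_pos_of_neg hγ0 (mul_neg_of_pos_of_neg (by linarith) (by linarith))
    linarith
  have p4 : ((1 + a - 2 * s) / 3 - a) *
      (1 - γ * ((1 + a - 2 * s) / 3 * (1 - (1 + a - 2 * s) / 3))) < 0 := by
    apply mul_neg_of_neg_of_pos (by linarith)
    have : γ * ((1 + a - 2 * s) / 3 * (1 - (1 + a - 2 * s) / 3)) < 0 :=
      mul_neg_of_pos_of_neg hγ0 (mul_neg_of_neg_of_pos (by linarith) (by linarith))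
    linarith
  have q1 := mul_neg_of_neg_of_pos (rcbrt_neg_aux p1) p2
  have q2 := mul_neg_of_pos_of_neg (rcbrt_pos_aux p3) p4
  refine ⟨q1, q2, ?_⟩
  intro c Ω₀ hc hΩ
  have r := rcbrt_pos_aux hpos
  apply mul_pos_of_neg_of_neg
  · rw [neg_lt_zero]
    positivity
  · exact add_neg (one_div_neg.mpr q1) (one_div_neg.mpr q2)
end

section
/- Let 0 < a < 1/2, 0 < γ < γ*(a), and c > 0. Then the function u ↦ −c f′(u)/(u − γ f(u) − a) is continuous on the intervals [ū₂, u₁] and [ū₁, u₂] (the denominators do not vanish there), and the singular passage times L_l = ∫_{u₁}^{ū₂} −c f′(u)/(u − γ f(u) − a) du and L_r = ∫_{ū₁}^{u₂} −c f′(u)/(u − γ f(u) − a) du are both finite and strictly positive. -/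
open Real MeasureTheory

lemma deriv_fcube (a u : ℝ) : deriv (fcube a) u = -3 * u ^ 2 + 2 * (1 + a) * u - a := by
  have h : HasDerivAt (fcube a) ((1 * (u - a) + u * 1) * (1 - u) + u * (u - a) * (-1)) u := by
    have h1 := ((hasDerivAt_id u).mul ((hasDerivAt_id u).sub_const a)).mul
      ((hasDerivAt_id u).const_sub 1)
    exact h1
  rw [h.deriv]; ring

/-- nonvanishing of the denominators and continuity of the integrand
`u ↦ −c f′(u)/(u − γ f(u) − a)` on `[ū₂, u₁]` and `[ū₁, u₂]`, and finiteness and strict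
positivity of the singular passage times `L_l` and `L_r`. -/
theorem stmt9 (a γ c : ℝ) (ha0 : 0 < a) (ha : a < 1 / 2)
    (hγ0 : 0 < γ) (hγ : γ < gammaStar a) (hc : 0 < c) :
    (∀ u ∈ Set.Icc (uBarTwo a) (uOne a), u - γ * fcube a u - a ≠ 0) ∧
    (∀ u ∈ Set.Icc (uBarOne a) (uTwo a), u - γ * fcube a u - a ≠ 0) ∧
    ContinuousOn (fun u : ℝ => -c * deriv (fcube a) u / (u - γ * fcube a u - a))
      (Set.Icc (uBarTwo a) (uOne a)) ∧
    ContinuousOn (fun u : ℝ => -c * deriv (fcube a) u / (u - γ * fcube a u - a))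
      (Set.Icc (uBarOne a) (uTwo a)) ∧
    IntervalIntegrable (fun u : ℝ => -c * deriv (fcube a) u / (u - γ * fcube a u - a))
      MeasureTheory.volume (uOne a) (uBarTwo a) ∧
    IntervalIntegrable (fun u : ℝ => -c * deriv (fcube a) u / (u - γ * fcube a u - a))
      MeasureTheory.volume (uBarOne a) (uTwo a) ∧
    0 < (∫ u in (uOne a)..(uBarTwo a), -c * deriv (fcube a) u / (u - γ * fcube a u - a)) ∧
    0 < (∫ u in (uBarOne a)..(uTwo a), -c * deriv (fcube a) u / (u - γ * fcube a u - a)) := by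
  obtain ⟨s, hs⟩ : ∃ s, s = Real.sqrt (1 - a + a ^ 2) := ⟨_, rfl⟩
  have hpos : 0 < 1 - a + a ^ 2 := by nlinarith
  have hs0 : 0 < s := hs ▸ Real.sqrt_pos.mpr hpos
  have hs2 : s ^ 2 = 1 - a + a ^ 2 := by rw [hs, Real.sq_sqrt hpos.le]
  have hsa : 1 - 2 * a < s := by nlinarith
  have e1 : uOne a = (1 + a - s) / 3 := by rw [uOne, hs]
  have e2 : uBarOne a = (1 + a + s) / 3 := by rw [uBarOne, hs]
  have e3 : uTwo a = (1 + a + 2 * s) / 3 := by rw [uTwo, hs]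
  have e4 : uBarTwo a = (1 + a - 2 * s) / 3 := by rw [uBarTwo, hs]
  have hg : γ * ((1 + 2 * a - 2 * a ^ 2 + (1 - 2 * a) * s) / 9) < 1 := by
    have hD : 0 < 1 + 2 * a - 2 * a ^ 2 + (1 - 2 * a) * s := by
      have := mul_pos (by linarith : 0 < 1 - 2 * a) hs0
      nlinarith
    rw [gammaStar, show a ^ 2 - a + 1 = 1 - a + a ^ 2 by ring, ← hs, lt_div_iff₀ hD] at hγ
    linarith
  have key : ∀ u, u * (1 - u) ≤ (1 + 2 * a - 2 * a ^ 2 + (1 - 2 * a) * s) / 9 →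
      0 < 1 - γ * (u * (1 - u)) := by
    intro u hu
    have := mul_le_mul_of_nonneg_left hu hγ0.le
    linarith
  have fac : ∀ u, u - γ * fcube a u - a = (u - a) * (1 - γ * (u * (1 - u))) := by
    intro u; rw [fcube]; ring
  have dL : ∀ u ∈ Set.Icc (uBarTwo a) (uOne a), u - γ * fcube a u - a < 0 := by
    rintro u ⟨_, hu⟩
    rw [e1] at hu
    rw [fac]
    apply mul_neg_of_neg_of_pos (by linarith)
    apply key
    have h1 : 0 ≤ ((1 + a - s) / 3 - u) * (1 - u - (1 + a - s) / 3) :=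
      mul_nonneg (by linarith) (by linarith)
    have h2 : 0 < (1 - 2 * a) * s := mul_pos (by linarith) hs0
    nlinarith
  have dR : ∀ u ∈ Set.Icc (uBarOne a) (uTwo a), 0 < u - γ * fcube a u - a := by
    rintro u ⟨hu, _⟩
    rw [e2] at hu
    rw [fac]
    apply mul_pos (by linarith)
    apply key
    have h1 : 0 ≤ (u - (1 + a + s) / 3) * (u + (1 + a + s) / 3 - 1) :=
      mul_nonneg (by linarith) (by linarith)
    nlinarith
  have fd : ∀ u, deriv (fcube a) u = -3 * ((u - (1 + a - s) / 3) * (u - (1 + a + s) / 3)) := by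
    intro u; rw [deriv_fcube]; linear_combination (-1 / 3) * hs2
  have cd : Continuous (deriv (fcube a)) := by
    have : deriv (fcube a) = fun u => -3 * u ^ 2 + 2 * (1 + a) * u - a :=
      funext (deriv_fcube a)
    rw [this]; fun_prop
  have cf : Continuous (fun u => u - γ * fcube a u - a) := by
    unfold fcube; fun_prop
  have cL : ContinuousOn (fun u : ℝ => -c * deriv (fcube a) u / (u - γ * fcube a u - a))
      (Set.Icc (uBarTwo a) (uOne a)) :=
    (continuous_const.mul cd).continuousOn.div cf.continuousOn (fun u hu => (dL u hu).ne)
  have cR : ContinuousOn (fun u : ℝ => -c * deriv (fcube a) u / (u - γ * fcube a u - a))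
      (Set.Icc (uBarOne a) (uTwo a)) :=
    (continuous_const.mul cd).continuousOn.div cf.continuousOn (fun u hu => (dR u hu).ne')
  have lL : uBarTwo a < uOne a := by rw [e1, e4]; linarith
  have lR : uBarOne a < uTwo a := by rw [e2, e3]; linarith
  have iL := cL.intervalIntegrable_of_Icc (μ := volume) lL.le
  have iR := cR.intervalIntegrable_of_Icc (μ := volume) lR.le
  refine ⟨fun u hu => (dL u hu).ne, fun u hu => (dR u hu).ne', cL, cR, iL.symm, iR, ?_, ?_⟩
  · rw [intervalIntegral.integral_symm, ← intervalIntegral.integral_neg]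
    refine intervalIntegral.intervalIntegral_pos_of_pos_on iL.neg ?_ lL
    intro u hu
    have h := dL u ⟨hu.1.le, hu.2.le⟩
    have hu2 := hu.2
    rw [e1] at hu2
    have hp : 0 < (u - (1 + a - s) / 3) * (u - (1 + a + s) / 3) :=
      mul_pos_of_neg_of_neg (by linarith) (by linarith)
    have := div_neg_of_pos_of_neg (a := -c * deriv (fcube a) u) (by rw [fd]; nlinarith [mul_pos hc hp]) h
    simpa using this
  · refine intervalIntegral.intervalIntegral_pos_of_pos_on iR ?_ lR
    intro u hu
    have h := dR u ⟨hu.1.le, hu.2.le⟩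
    have hu1 := hu.1
    rw [e2] at hu1
    have hp : 0 < (u - (1 + a - s) / 3) * (u - (1 + a + s) / 3) :=
      mul_pos (by linarith) (by linarith)
    exact div_pos (by rw [fd]; nlinarith [mul_pos hc hp]) h
end

section
/- Let 0 < a < 1/2, 0 < γ < γ*(a), and c > 0, and let L_l, L_r be as in the context. Then there exists a continuous strictly decreasing function u_l : [0, L_l] → ℝ with u_l(0) = u₁, u_l(L_l) = ū₂, ū₂ ≤ u_l(y) < u₁ for all y ∈ (0, L_l], which is continuously differentiable on (0, L_l] and satisfies the reduced slow equation c f′(u_l(y)) u_l′(y) = γ f(u_l(y)) + a − u_l(y) for all y ∈ (0, L_l]. Likewise, there exists a continuous strictly increasing u_r : [0, L_r] → ℝ with u_r(0) = ū₁, u_r(L_r) = u₂, ū₁ < u_r(y) ≤ u₂ for all y ∈ (0, L_r], continuously differentiable on (0, L_r] and satisfying c f′(u_r(y)) u_r′(y) = γ f(u_r(y)) + a − u_r(y) there. -/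
open Real MeasureTheory

/-- The singular passage time along the left branch. -/
noncomputable def Lleft (a γ c : ℝ) : ℝ :=
  ∫ u in (uOne a)..(uBarTwo a), -c * deriv (fcube a) u / (u - γ * fcube a u - a)

/-- The singular passage time along the right branch. -/
noncomputable def Lright (a γ c : ℝ) : ℝ :=
  ∫ u in (uBarOne a)..(uTwo a), -c * deriv (fcube a) u / (u - γ * fcube a u - a)


lemma aux_inv (p q r : ℝ) (hpq : p < q) (hqr : q < r) (g : ℝ → ℝ)
    (hgc : ContinuousOn g (Set.Icc p r)) (hgp : ∀ x ∈ Set.Ioc p r, 0 < g x) (L : ℝ)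
    (hL : L = ∫ x in p..q, g x) :
    ∃ v : ℝ → ℝ, Continuous v ∧ StrictMono v ∧ v 0 = p ∧ v L = q ∧
      (∀ y ∈ Set.Ioc 0 L, p < v y ∧ v y ≤ q) ∧
      (∀ y ∈ Set.Ioc 0 L, HasDerivAt v (g (v y))⁻¹ y) := by
  have hpr : p < r := hpq.trans hqr
  have hint : ∀ x ∈ Set.Icc p r, ∀ y ∈ Set.Icc p r, IntervalIntegrable g volume x y := by
    intro x hx y hy
    apply ContinuousOn.intervalIntegrable
    exact hgc.mono (Set.uIcc_subset_Icc hx hy)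
  set G : ℝ → ℝ := fun x => ∫ t in p..x, g t with hG
  have hp : p ∈ Set.Icc p r := ⟨le_rfl, hpr.le⟩
  have hGd : ∀ x ∈ Set.Ioo p r, HasDerivAt G (g x) x := by
    intro x hx
    have hc : ContinuousAt g x := hgc.continuousAt (Icc_mem_nhds hx.1 hx.2)
    apply intervalIntegral.integral_hasDerivAt_right (hint p hp x ⟨hx.1.le, hx.2.le⟩) _ hc
    exact ContinuousOn.stronglyMeasurableAtFilter isOpen_Ioo
      (hgc.mono Set.Ioo_subset_Icc_self) x hx
  have hGc : ContinuousOn G (Set.Icc p r) := by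
    have := intervalIntegral.continuousOn_primitive_interval
      (μ := volume) (f := g) (a := p) (b := r) 
      (by rw [Set.uIcc_of_le hpr.le]; exact hgc.integrableOn_Icc)
    rwa [Set.uIcc_of_le hpr.le] at this
  have hGm : StrictMonoOn G (Set.Icc p r) := by
    apply strictMonoOn_of_deriv_pos (convex_Icc p r) hGc
    intro x hx
    rw [interior_Icc] at hx
    rw [(hGd x hx).deriv]
    exact hgp x ⟨hx.1, hx.2.le⟩
  set P : ℝ → ℝ := fun x => max p (min x r) with hP
  have hPm : ∀ x, P x ∈ Set.Icc p r := fun x => 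
    ⟨le_max_left _ _, max_le hpr.le (min_le_right _ _)⟩
  have hPid : ∀ x ∈ Set.Icc p r, P x = x := by
    intro x hx
    simp only [hP]
    rw [min_eq_left hx.2, max_eq_right hx.1]
  have hPc : Continuous P := by fun_prop
  set H : ℝ → ℝ := fun x => G (P x) + (x - P x) with hH
  have hHc : Continuous H := by
    have : Continuous (fun x => G (P x)) := hGc.comp_continuous hPc hPm
    exact this.add (continuous_id.sub hPc)
  have hHm : StrictMono H := by
    intro x y hxy
    have h1 : P x ≤ P y := max_le_max le_rfl (min_le_min hxy.le le_rfl)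
    have h2 : x - P x ≤ y - P y := by
      simp only [hP]
      rcases max_cases p (min x r) with h | h <;> rcases max_cases p (min y r) with h' | h' <;>
      rcases min_cases x r with h3 | h3 <;> rcases min_cases y r with h4 | h4 <;> linarith
    rcases h1.lt_or_eq with h | h
    · have := hGm (hPm x) (hPm y) h
      simp only [hH]; linarith
    · simp only [hH, h]; linarith
  have hGp : G p = 0 := by simp [hG]
  have hHs : Function.Surjective H := by
    apply hHc.surjective
    · apply Filter.tendsto_atTop_mono (f := fun x => x - r)
      · intro x
        have h1 := hGm.monotoneOn hp (hPm x) (hPm x).1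
        have h2 := (hPm x).2
        simp only [hH]; linarith
      · exact Filter.tendsto_atTop_add_const_right _ (-r) Filter.tendsto_id
    · apply Filter.tendsto_atBot_mono (g := H) (f := fun x => x + (G r - p))
      · intro x
        have h1 := hGm.monotoneOn (hPm x) ⟨hpr.le, le_rfl⟩ (hPm x).2
        have h2 := (hPm x).1
        simp only [hH]; linarith
      · exact Filter.tendsto_atBot_add_const_right _ _ Filter.tendsto_id
  let e : ℝ ≃o ℝ := hHm.orderIsoOfSurjective H hHs
  have he : ∀ x, e x = H x := fun x => rfl
  have hHG : ∀ x ∈ Set.Icc p r, H x = G x := by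
    intro x hx
    simp only [hH, hPid x hx]; ring
  have e0 : e.symm 0 = p := by
    rw [OrderIso.symm_apply_eq, he, hHG p hp, hGp]
  have eL : e.symm L = q := by
    rw [OrderIso.symm_apply_eq, he, hHG q ⟨hpq.le, hqr.le⟩, hL]
  have hb : ∀ y ∈ Set.Ioc 0 L, p < e.symm y ∧ e.symm y ≤ q := by
    intro y hy
    constructor
    · rw [← e0]; exact e.symm.strictMono hy.1
    · rw [← eL]; exact e.symm.monotone hy.2
  refine ⟨e.symm, e.symm.continuous, e.symm.strictMono, e0, eL, hb, ?_⟩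
  intro y hy
  obtain ⟨h1, h2⟩ := hb y hy
  have hm : e.symm y ∈ Set.Ioo p r := ⟨h1, h2.trans_lt hqr⟩
  have hd : HasDerivAt H (g (e.symm y)) (e.symm y) := by
    apply (hGd _ hm).congr_of_eventuallyEq
    filter_upwards [Icc_mem_nhds hm.1 hm.2] with x hx using hHG x hx
  exact HasDerivAt.of_local_left_inverse e.symm.continuous.continuousAt hd
    (hgp _ ⟨h1, h2.trans hqr.le⟩).ne'
    (Filter.Eventually.of_forall fun z => e.apply_symm_apply z)

lemma fcube_deriv (a u : ℝ) : 
    deriv (fcube a) u = -3 * (u - uOne a) * (u - uBarOne a) := by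
  have h : HasDerivAt (fcube a) ((1 * (u - a) + u * 1) * (1 - u) + u * (u - a) * (-1)) u := by
    unfold fcube
    exact (((hasDerivAt_id u).mul ((hasDerivAt_id u).sub_const a)).mul
      ((hasDerivAt_id u).const_sub 1))
  rw [h.deriv]
  have hs : Real.sqrt (1 - a + a ^ 2) ^ 2 = 1 - a + a ^ 2 :=
    Real.sq_sqrt (by nlinarith [sq_nonneg (a - 1)])
  unfold uOne uBarOne
  linear_combination (-1/3) * hs

lemma sqrt_facts (a : ℝ) (ha0 : 0 < a) (ha : a < 1 / 2) :
    1 - a < Real.sqrt (1 - a + a ^ 2) ∧ Real.sqrt (1 - a + a ^ 2) < 1 ∧ 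
    Real.sqrt (1 - a + a ^ 2) ^ 2 = 1 - a + a ^ 2 := by
  refine ⟨?_, ?_, Real.sq_sqrt (by nlinarith)⟩
  · apply Real.lt_sqrt_of_sq_lt; nlinarith
  · rw [Real.sqrt_lt' one_pos]; nlinarith

lemma gamma_bd (a γ : ℝ) (ha0 : 0 < a) (ha : a < 1 / 2) (hγ : γ < gammaStar a) :
    γ * (uBarOne a * (1 - uBarOne a)) < 1 := by
  obtain ⟨h1, h2, h3⟩ := sqrt_facts a ha0 ha
  unfold gammaStar at hγ
  rw [show a ^ 2 - a + 1 = 1 - a + a ^ 2 by ring] at hγ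
  unfold uBarOne
  set s := Real.sqrt (1 - a + a ^ 2)
  have hD : 0 < 1 + 2 * a - 2 * a ^ 2 + (1 - 2 * a) * s := by nlinarith
  rw [lt_div_iff₀ hD] at hγ
  have : (1 + a + s) / 3 * (1 - (1 + a + s) / 3) 
    = (1 + 2 * a - 2 * a ^ 2 + (1 - 2 * a) * s) / 9 := by linear_combination (-1/9) * h3
  rw [this]; linarith

lemma den_left (a γ u : ℝ) (ha0 : 0 < a) (ha : a < 1 / 2) (hγ0 : 0 < γ)
    (hγ : γ < gammaStar a) (hu : u ≤ uOne a) : u - γ * fcube a u - a < 0 := by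
  have hb := gamma_bd a γ ha0 ha hγ
  obtain ⟨h1, h2, h3⟩ := sqrt_facts a ha0 ha
  have e : u - γ * fcube a u - a = (u - a) * (1 - γ * (u * (1 - u))) := by
    unfold fcube; ring
  rw [e]
  have hle : u * (1 - u) ≤ uBarOne a * (1 - uBarOne a) := by
    unfold uBarOne uOne at *
    set s := Real.sqrt (1 - a + a ^ 2)
    have : (0:ℝ) ≤ ((1 + a + s) / 3 - u) * (1 - u - (1 + a + s) / 3) :=
      mul_nonneg (by linarith) (by linarith)
    linarith
  have := mul_le_mul_of_nonneg_left hle hγ0.le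
  apply mul_neg_of_neg_of_pos _ (by linarith)
  unfold uOne at hu
  linarith

lemma den_right (a γ u : ℝ) (ha0 : 0 < a) (ha : a < 1 / 2) (hγ0 : 0 < γ)
    (hγ : γ < gammaStar a) (hu : uBarOne a ≤ u) : 0 < u - γ * fcube a u - a := by
  have hb := gamma_bd a γ ha0 ha hγ
  obtain ⟨h1, h2, h3⟩ := sqrt_facts a ha0 ha
  have e : u - γ * fcube a u - a = (u - a) * (1 - γ * (u * (1 - u))) := by
    unfold fcube; ring
  rw [e]
  have hle : u * (1 - u) ≤ uBarOne a * (1 - uBarOne a) := by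
    unfold uBarOne at *
    set s := Real.sqrt (1 - a + a ^ 2)
    have : (0:ℝ) ≤ (u - (1 + a + s) / 3) * (u + (1 + a + s) / 3 - 1) :=
      mul_nonneg (by linarith) (by linarith)
    linarith
  have := mul_le_mul_of_nonneg_left hle hγ0.le
  apply mul_pos _ (by linarith)
  unfold uBarOne at hu
  linarith

/-- existence of the reduced slow solutions `u_l` on `[0, L_l]` (strictly
decreasing, from `u₁` to `ū₂`) and `u_r` on `[0, L_r]` (strictly increasing, from `ū₁` to
`u₂`), continuously differentiable on the half-open intervals and satisfying the reduced
slow equation `c f′(u) u′ = γ f(u) + a − u` there. -/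
theorem stmt10 (a γ c : ℝ) (ha0 : 0 < a) (ha : a < 1 / 2)
    (hγ0 : 0 < γ) (hγ : γ < gammaStar a) (hc : 0 < c) :
    (∃ ul ul' : ℝ → ℝ,
      ContinuousOn ul (Set.Icc 0 (Lleft a γ c)) ∧
      StrictAntiOn ul (Set.Icc 0 (Lleft a γ c)) ∧
      ul 0 = uOne a ∧ ul (Lleft a γ c) = uBarTwo a ∧
      (∀ y ∈ Set.Ioc 0 (Lleft a γ c), uBarTwo a ≤ ul y ∧ ul y < uOne a) ∧
      ContinuousOn ul' (Set.Ioc 0 (Lleft a γ c)) ∧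
      (∀ y ∈ Set.Ioc 0 (Lleft a γ c), HasDerivAt ul (ul' y) y) ∧
      (∀ y ∈ Set.Ioc 0 (Lleft a γ c),
        c * deriv (fcube a) (ul y) * ul' y = γ * fcube a (ul y) + a - ul y)) ∧
    (∃ ur ur' : ℝ → ℝ,
      ContinuousOn ur (Set.Icc 0 (Lright a γ c)) ∧
      StrictMonoOn ur (Set.Icc 0 (Lright a γ c)) ∧
      ur 0 = uBarOne a ∧ ur (Lright a γ c) = uTwo a ∧
      (∀ y ∈ Set.Ioc 0 (Lright a γ c), uBarOne a < ur y ∧ ur y ≤ uTwo a) ∧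
      ContinuousOn ur' (Set.Ioc 0 (Lright a γ c)) ∧
      (∀ y ∈ Set.Ioc 0 (Lright a γ c), HasDerivAt ur (ur' y) y) ∧
      (∀ y ∈ Set.Ioc 0 (Lright a γ c),
        c * deriv (fcube a) (ur y) * ur' y = γ * fcube a (ur y) + a - ur y)) := by
  obtain ⟨h1, h2, h3⟩ := sqrt_facts a ha0 ha
  have h12 : uBarTwo a < uOne a := by unfold uBarTwo uOne; linarith
  have h11 : uOne a < uBarOne a := by unfold uBarOne uOne; linarith
  have h22 : uBarOne a < uTwo a := by unfold uBarOne uTwo; linarith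
  have hdc : Continuous (deriv (fcube a)) := by
    rw [funext (fcube_deriv a)]; fun_prop
  have hfc : Continuous (fcube a) := by unfold fcube; fun_prop
  set h : ℝ → ℝ := fun u => -c * deriv (fcube a) u / (u - γ * fcube a u - a) with hh
  have hposr : ∀ u, uBarOne a < u → 0 < h u := by
    intro u hu
    apply div_pos _ (den_right a γ u ha0 ha hγ0 hγ hu.le)
    rw [fcube_deriv]
    have : 0 < (u - uOne a) * (u - uBarOne a) := mul_pos (by linarith) (by linarith)
    nlinarith [mul_pos hc this]
  have hnegl : ∀ u, u < uOne a → h u < 0 := by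
    intro u hu
    apply div_neg_of_pos_of_neg _ (den_left a γ u ha0 ha hγ0 hγ hu.le)
    rw [fcube_deriv]
    have : 0 < (u - uOne a) * (u - uBarOne a) := 
      mul_pos_of_neg_of_neg (by linarith) (by linarith)
    nlinarith [mul_pos hc this]
  have hcr : ContinuousOn h (Set.Ici (uBarOne a)) := by
    apply ContinuousOn.div (by fun_prop) (by fun_prop)
    intro x hx
    exact (den_right a γ x ha0 ha hγ0 hγ hx).ne'
  have hcl : ContinuousOn h (Set.Iic (uOne a)) := by
    apply ContinuousOn.div (by fun_prop) (by fun_prop)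
    intro x hx
    exact (den_left a γ x ha0 ha hγ0 hγ hx).ne
  have halg : ∀ u, h u ≠ 0 → c * deriv (fcube a) u * (h u)⁻¹ = γ * fcube a u + a - u := by
    intro u hu
    simp only [hh] at hu ⊢
    rw [div_ne_zero_iff] at hu
    have h4 : deriv (fcube a) u ≠ 0 := by
      intro h0; apply hu.1; rw [h0]; ring
    rw [inv_div]
    field_simp
    ring
  constructor
  · obtain ⟨v, vc, vm, v0, vL, vb, vd⟩ := aux_inv (-uOne a) (-uBarTwo a) (-uBarTwo a + 1)
      (by linarith) (by linarith) (fun x => -h (-x))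
      (by
        apply ContinuousOn.neg
        apply hcl.comp (by fun_prop)
        intro x hx
        have := hx.1
        simp only [Set.mem_Iic]; linarith)
      (by
        intro x hx
        have := hnegl (-x) (by linarith [hx.1])
        linarith) (Lleft a γ c)
      (by
        rw [intervalIntegral.integral_neg, intervalIntegral.integral_comp_neg (fun x => h x),
          neg_neg, neg_neg, ← intervalIntegral.integral_symm]
        rfl)
    have hne : ∀ y ∈ Set.Ioc 0 (Lleft a γ c), h (-v y) < 0 := fun y hy =>
      hnegl _ (by linarith [(vb y hy).1])
    refine ⟨fun y => -v y, fun y => (h (-v y))⁻¹, vc.neg.continuousOn, 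
      fun x _ y _ hxy => neg_lt_neg (vm hxy), by simp [v0], by simp [vL], ?_, ?_, ?_, ?_⟩
    · intro y hy
      have := vb y hy
      constructor <;> linarith
    · apply ContinuousOn.inv₀
      · apply hcl.comp (by fun_prop)
        intro y hy
        have := (vb y hy).1
        simp only [Set.mem_Iic]; linarith
      · intro y hy
        exact (hne y hy).ne
    · intro y hy
      have := (vd y hy).neg
      have h5 : -(-h (-v y))⁻¹ = (h (-v y))⁻¹ := by rw [inv_neg, neg_neg]
      rw [h5] at this
      exact this
    · intro y hy
      exact halg _ (hne y hy).ne
  · obtain ⟨v, vc, vm, v0, vL, vb, vd⟩ := aux_inv (uBarOne a) (uTwo a) (uTwo a + 1)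
      (by linarith) (by linarith) h (hcr.mono fun x hx => hx.1)
      (fun x hx => hposr x hx.1) (Lright a γ c) rfl
    have hne : ∀ y ∈ Set.Ioc 0 (Lright a γ c), 0 < h (v y) := fun y hy =>
      hposr _ (vb y hy).1
    refine ⟨v, fun y => (h (v y))⁻¹, vc.continuousOn, vm.strictMonoOn _, v0, vL, vb, ?_, vd, ?_⟩
    · apply ContinuousOn.inv₀
      · exact hcr.comp vc.continuousOn fun y hy => (vb y hy).1.le
      · intro y hy
        exact (hne y hy).ne'
    · intro y hy
      exact halg _ (hne y hy).ne'
end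

section
/- Let 0 < a < 1/2, 0 < γ < γ*(a), c > 0, and 0 < ν < L. Suppose u : [ν, L] → ℝ is continuously differentiable with ū₂ ≤ u(y) < u₁ for all y ∈ [ν, L] and satisfies the reduced slow equation c f′(u(y)) u′(y) = γ f(u(y)) + a − u(y) on [ν, L]. Then −(γ/c)(L − ν) + ∫_ν^L 1/(c f′(u(y))) dy = log( (u(ν) − γ f(u(ν)) − a) / (u(L) − γ f(u(L)) − a) ), where both the numerator and denominator inside the logarithm are strictly negative. -/
open Real MeasureTheory

theorem fcube_hasDeriv (a u : ℝ) : HasDerivAt (fcube a) (-3*u^2+2*(1+a)*u-a) u := by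
  have h := (((hasDerivAt_id u).mul ((hasDerivAt_id u).sub_const a)).mul
    ((hasDerivAt_id u).const_sub 1))
  refine (h.congr_deriv ?_).congr_of_eventuallyEq (Filter.Eventually.of_forall fun x => ?_)
  · simp; ring
  · simp [fcube]

theorem fcube_deriv_neg (a u : ℝ) (hu : u < uOne a) : -3*u^2+2*(1+a)*u-a < 0 := by
  unfold uOne at hu
  have hs : 0 ≤ 1 - a + a^2 := by nlinarith [sq_nonneg (a - 1/2)]
  have h1 := Real.sq_sqrt hs
  have h0 := Real.sqrt_nonneg (1 - a + a^2)
  set s := Real.sqrt (1 - a + a^2)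
  have h2 : 0 < (1 + a - s) / 3 - u := by linarith
  have h3 : 0 < (1 + a + s) / 3 - u := by linarith
  nlinarith [mul_pos h2 h3]

theorem g_neg (a γ u : ℝ) (ha0 : 0 < a) (ha : a < 1 / 2)
    (hγ0 : 0 < γ) (hγ : γ < gammaStar a) (hu : u < uOne a) :
    u - γ * fcube a u - a < 0 := by
  unfold uOne at hu
  unfold gammaStar at hγ
  rw [show a^2 - a + 1 = 1 - a + a^2 by ring] at hγ
  have hs : 0 ≤ 1 - a + a^2 := by nlinarith [sq_nonneg (a - 1/2)]
  have h1 := Real.sq_sqrt hs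
  have h0 := Real.sqrt_nonneg (1 - a + a^2)
  set s := Real.sqrt (1 - a + a^2)
  have hm : 0 ≤ (1 - 2*a) * s := mul_nonneg (by linarith) h0
  have hD : 0 < 1 + 2 * a - 2 * a ^ 2 + (1 - 2 * a) * s := by nlinarith
  rw [lt_div_iff₀ hD] at hγ
  have hsl : 1 - 2*a ≤ s := by nlinarith
  have hsa : 1 - 2*a < s := by nlinarith
  have hua : u < a := by linarith
  have hq : u * (1 - u) ≤ (1 + 2 * a - 2 * a ^ 2 + (1 - 2 * a) * s) / 9 := by
    have : 0 ≤ ((1 + a - s) / 3 - u) * (1 - (1 + a - s) / 3 - u) :=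
      mul_nonneg (by linarith) (by linarith)
    nlinarith
  have hp : 0 < 1 - γ * (u * (1 - u)) := by
    have := mul_le_mul_of_nonneg_left hq hγ0.le
    linarith
  have := mul_pos (sub_pos.2 hua) hp
  unfold fcube
  nlinarith

/-- the logarithmic identity for a C¹ solution of the reduced slow equation
along the left branch, with strictly negative numerator and denominator inside the log. -/
theorem stmt11 (a γ c ν L : ℝ) (ha0 : 0 < a) (ha : a < 1 / 2)
    (hγ0 : 0 < γ) (hγ : γ < gammaStar a) (hc : 0 < c) (hν : 0 < ν) (hνL : ν < L)
    (u u' : ℝ → ℝ)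
    (hderiv : ∀ y ∈ Set.Icc ν L, HasDerivAt u (u' y) y)
    (hcont : ContinuousOn u' (Set.Icc ν L))
    (hrange : ∀ y ∈ Set.Icc ν L, uBarTwo a ≤ u y ∧ u y < uOne a)
    (hode : ∀ y ∈ Set.Icc ν L,
      c * deriv (fcube a) (u y) * u' y = γ * fcube a (u y) + a - u y) :
    u ν - γ * fcube a (u ν) - a < 0 ∧
    u L - γ * fcube a (u L) - a < 0 ∧
    -(γ / c) * (L - ν) + (∫ y in ν..L, 1 / (c * deriv (fcube a) (u y)))
      = Real.log ((u ν - γ * fcube a (u ν) - a) / (u L - γ * fcube a (u L) - a)) := by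
  have hd : deriv (fcube a) = fun u => -3*u^2+2*(1+a)*u-a :=
    funext fun x => (fcube_hasDeriv a x).deriv
  simp only [hd] at hode ⊢
  have hg : ∀ y ∈ Set.Icc ν L, u y - γ * fcube a (u y) - a < 0 := fun y hy =>
    g_neg a γ (u y) ha0 ha hγ0 hγ (hrange y hy).2
  have hf : ∀ y ∈ Set.Icc ν L, -3*(u y)^2+2*(1+a)*(u y)-a < 0 := fun y hy =>
    fcube_deriv_neg a (u y) (hrange y hy).2
  have hνm : ν ∈ Set.Icc ν L := ⟨le_rfl, hνL.le⟩
  have hLm : L ∈ Set.Icc ν L := ⟨hνL.le, le_rfl⟩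
  refine ⟨hg ν hνm, hg L hLm, ?_⟩
  have hI : Set.uIcc ν L = Set.Icc ν L := Set.uIcc_of_le hνL.le
  have huc : ContinuousOn u (Set.Icc ν L) := fun y hy =>
    (hderiv y hy).continuousAt.continuousWithinAt
  have hint : IntervalIntegrable (fun y => 1 / (c * (-3*(u y)^2+2*(1+a)*(u y)-a))) volume ν L := by
    apply ContinuousOn.intervalIntegrable
    rw [hI]
    apply ContinuousOn.div continuousOn_const (by fun_prop)
    intro y hy
    exact mul_ne_zero hc.ne' (hf y hy).ne
  have key : ∀ y ∈ Set.uIcc ν L, HasDerivAt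
      (fun y => Real.log (u y - γ * fcube a (u y) - a))
      (γ / c - 1 / (c * (-3*(u y)^2+2*(1+a)*(u y)-a))) y := by
    intro y hy
    rw [hI] at hy
    have h1 := ((fcube_hasDeriv a (u y)).comp y (hderiv y hy)).const_mul γ
    have h2 := (((hderiv y hy).sub h1).sub_const a).log (hg y hy).ne
    refine h2.congr_deriv ?_
    have e := hode y hy
    have n1 := (hf y hy).ne
    have n2 := (hg y hy).ne
    try simp only at e
    try simp only [Pi.sub_apply, Function.comp_apply]
    generalize -3*(u y)^2+2*(1+a)*(u y)-a = p at *
    have hu' : u' y = -(u y - γ * fcube a (u y) - a) / (c * p) := by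
      rw [eq_div_iff (mul_ne_zero hc.ne' n1)]; linarith
    rw [hu']
    generalize u y - γ * fcube a (u y) - a = g at *
    rw [div_eq_iff n2]
    field_simp
    ring
  have hft := intervalIntegral.integral_eq_sub_of_hasDerivAt key
    (intervalIntegrable_const.sub hint)
  rw [intervalIntegral.integral_sub intervalIntegrable_const hint,
    intervalIntegral.integral_const, smul_eq_mul] at hft
  rw [Real.log_div (hg ν hνm).ne (hg L hLm).ne]
  linarith
end
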